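/- arXiv:2205.01792 — 2 statements merged into one kernel-verified Lean document; each statement's English description precedes it below -/
import Mathlib

section
/- Let Γ be the graph of a faithful transitive right action of a group G generated by a finite symmetric set S, satisfying conditions (1) and (2). Then for all 1 ≤ p_1 < p_2 there exists a constant C_{p_1,p_2}, depending only on Γ, p_1, p_2, such that N_{p_1}(g) ≤ C_{p_1,p_2}·N_{p_2}(g) for all g ∈ G. -/
noncomputable section

namespace ActionGrowth

variable {G V : Type} [Group G]

/-- The product in `G` of a word over the generating set `S`. -/
def wordProd (S : Set G) (w : List S) : G := (w.map (fun s => (s : G))).prod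

/-- The (vertex set of the) ball of radius `R` centered at `v` in the graph of the
right action `act` of `G` on `V` with respect to the symmetric generating set `S`. -/
def ball (act : V → G → V) (S : Set G) (v : V) (R : ℕ) : Set V :=
  {u | ∃ w : List S, w.length ≤ R ∧ act v (wordProd S w) = u}

/-- Graph distance in the graph of the action (for a symmetric generating set `S`). -/
def gdist (act : V → G → V) (S : Set G) (v u : V) : ℕ :=
  sInf {n | u ∈ ball act S v n}

/-- `R_w(v)`: the maximum over the prefixes `s₁ ⋯ s_i` of `w` of the distances
`d(v, v · s₁ ⋯ s_i)`, i.e. the minimal radius of a ball centered at `v`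
containing the path labeled `w` starting at `v`. -/
def rad (act : V → G → V) (S : Set G) (w : List S) (v : V) : ℕ :=
  (Finset.range (w.length + 1)).sup fun i => gdist act S v (act v (wordProd S (w.take i)))

/-- Isomorphism of the rooted labeled balls `(B_v(R), v)` and `(B_u(R), u)`:
a bijection of the balls sending root to root and preserving the labeled edges
of the spanned subgraphs. -/
def BallIso (act : V → G → V) (S : Set G) (R : ℕ) (v u : V) : Prop :=
  ∃ φ : V → V, Set.BijOn φ (ball act S v R) (ball act S u R) ∧ φ v = u ∧
    ∀ x ∈ ball act S v R, ∀ y ∈ ball act S v R, ∀ s : S,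
      (act x (s : G) = y ↔ act (φ x) (s : G) = φ y)

/-- `δ_Γ(R)`: the number of isomorphism classes of rooted balls `(B_v(R), v)`. -/
def ballTypes (act : V → G → V) (S : Set G) (R : ℕ) : ℕ :=
  Nat.card (Quot (BallIso act S R))

/-- `γ_Γ(R)`: the maximal number of vertices of a ball of radius `R` in `Γ`. -/
def graphGrowth (act : V → G → V) (S : Set G) (R : ℕ) : ℕ :=
  ⨆ v : V, Nat.card (ball act S v R)

/-- Isomorphism of the elements `(B_v(R_w(v)), v, v·w)` and `(B_u(R_w(u)), u, u·w)`
of the standard portrait of `w`: a bijection of the balls matching both roots and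
preserving the labeled edges. -/
def PortraitRel (act : V → G → V) (S : Set G) (w : List S) (v u : V) : Prop :=
  ∃ φ : V → V,
    Set.BijOn φ (ball act S v (rad act S w v)) (ball act S u (rad act S w u)) ∧
    φ v = u ∧ φ (act v (wordProd S w)) = act u (wordProd S w) ∧
    ∀ x ∈ ball act S v (rad act S w v), ∀ y ∈ ball act S v (rad act S w v), ∀ s : S,
      (act x (s : G) = y ↔ act (φ x) (s : G) = φ y)

/-- `#P_w`: the number of elements (isomorphism classes of bi-rooted balls)
of the standard portrait of the word `w`. -/
def portraitCard (act : V → G → V) (S : Set G) (w : List S) : ℕ :=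
  Nat.card (Quot (PortraitRel act S w))

/-- The ball of radius `R` in the group `G` with respect to `S`:
elements of word length at most `R`. -/
def ballG (S : Set G) (R : ℕ) : Set G :=
  {g | ∃ w : List S, w.length ≤ R ∧ wordProd S w = g}

/-- `γ_G(R)`: the growth function of `G` with respect to `S`. -/
def groupGrowth (S : Set G) (R : ℕ) : ℕ := Nat.card (ballG S R)

/-- `L(g)`: the minimal size of a standard portrait `P_w` among words `w`
representing `g`. -/
def Lg (act : V → G → V) (S : Set G) (g : G) : ℕ :=
  sInf {m | ∃ w : List S, wordProd S w = g ∧ portraitCard act S w = m}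

/-- `L(R)`: the maximum of `L(g)` over elements with `|g| ≤ R`. -/
def LR (act : V → G → V) (S : Set G) (R : ℕ) : ℕ :=
  ⨆ g : ballG S R, Lg act S (g : G)

/-- `N_p(w)^p = Σ_{(B,x,y) ∈ P_w} (#B)^{p-1}`, the sum over the isomorphism
classes of the standard portrait of `w`. -/
def Npow (act : V → G → V) (S : Set G) (w : List S) (p : ℝ) : ℝ :=
  ∑' q : Quot (PortraitRel act S w),
    (Nat.card (ball act S (Quot.out q) (rad act S w (Quot.out q))) : ℝ) ^ (p - 1)

/-- `N_p(w) = (Σ_{(B,x,y) ∈ P_w} (#B)^{p-1})^{1/p}`. -/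
def Np (act : V → G → V) (S : Set G) (w : List S) (p : ℝ) : ℝ :=
  Npow act S w p ^ (1 / p)

/-- `N_p(g)`: the infimum of `N_p(w)` over words `w` representing `g`. -/
def Npg (act : V → G → V) (S : Set G) (g : G) (p : ℝ) : ℝ :=
  sInf {x : ℝ | ∃ w : List S, wordProd S w = g ∧ Np act S w p = x}

/-- `N_p(R)`: the maximum of `N_p(g)` over elements of length at most `R`. -/
def NpR (act : V → G → V) (S : Set G) (R : ℕ) (p : ℝ) : ℝ :=
  sSup {x : ℝ | ∃ g ∈ ballG S R, Npg act S g p = x}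


/-- An isomorphic embedding of the labeled ball `B_v(R)` into the labeled ball
`B_{v'}(R')`. -/
def IsBallEmbedding (act : V → G → V) (S : Set G) (v v' : V) (R R' : ℕ) (ψ : V → V) : Prop :=
  Set.InjOn ψ (ball act S v R) ∧
  Set.MapsTo ψ (ball act S v R) (ball act S v' R') ∧
  ∀ x ∈ ball act S v R, ∀ y ∈ ball act S v R, ∀ s : S,
    (act x (s : G) = y ↔ act (ψ x) (s : G) = ψ y)


theorem wordProd_concat (S : Set G) (w : List S) (s : S) :
    wordProd S (w ++ [s]) = wordProd S w * (s : G) := by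
  simp [wordProd]

theorem mem_ball_self {act : V → G → V} (hact_one : ∀ v : V, act v 1 = v)
    (S : Set G) (v : V) (R : ℕ) : v ∈ ball act S v R :=
  ⟨[], by simp, by simp [wordProd, hact_one]⟩

theorem ball_mono (act : V → G → V) (S : Set G) (v : V) {R R' : ℕ} (h : R ≤ R') :
    ball act S v R ⊆ ball act S v R' := by
  rintro u ⟨w, hw, rfl⟩
  exact ⟨w, hw.trans h, rfl⟩

theorem gdist_le {act : V → G → V} {S : Set G} {v u : V} {n : ℕ}
    (h : u ∈ ball act S v n) : gdist act S v u ≤ n :=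
  Nat.sInf_le h

theorem mem_ball_gdist {act : V → G → V} {S : Set G} {v u : V} {n : ℕ}
    (h : u ∈ ball act S v n) : u ∈ ball act S v (gdist act S v u) :=
  Nat.sInf_mem (s := {n | u ∈ ball act S v n}) ⟨n, h⟩

/-- Every vertex of the path labeled `w` starting at `v` lies in the ball of radius `R_w(v)`. -/
theorem act_take_mem_ball (act : V → G → V) (S : Set G) (w : List S) (v : V) (i : ℕ) :
    act v (wordProd S (w.take i)) ∈ ball act S v (rad act S w v) := by
  rcases le_total i w.length with hi | hi
  · have hle : gdist act S v (act v (wordProd S (w.take i))) ≤ rad act S w v :=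
      Finset.le_sup (f := fun i => gdist act S v (act v (wordProd S (w.take i))))
        (Finset.mem_range.2 (Nat.lt_succ_of_le hi))
    exact ball_mono act S v hle (mem_ball_gdist ⟨w.take i, le_rfl, rfl⟩)
  · have hle : gdist act S v (act v (wordProd S (w.take w.length))) ≤ rad act S w v :=
      Finset.le_sup (f := fun i => gdist act S v (act v (wordProd S (w.take i))))
        (Finset.mem_range.2 (Nat.lt_succ_self _))
    rw [List.take_of_length_le hi]
    rw [List.take_length] at hle
    exact ball_mono act S v hle (mem_ball_gdist ⟨w, le_rfl, rfl⟩)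

namespace IsBallEmbedding

variable {act : V → G → V} {S : Set G} {v v' : V} {R R' : ℕ} {ψ : V → V}

/-- A ball embedding is equivariant along every path that stays in the ball. -/
theorem map_act (hψ : IsBallEmbedding act S v v' R R' ψ) (hact_one : ∀ v : V, act v 1 = v)
    (hact_mul : ∀ (v : V) (g h : G), act (act v g) h = act v (g * h)) (w : List S)
    (hw : ∀ x : List S, x <+: w → act v (wordProd S x) ∈ ball act S v R) :
    ψ (act v (wordProd S w)) = act (ψ v) (wordProd S w) := by
  induction w using List.reverseRecOn with
  | nil => simp [wordProd, hact_one]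
  | append_singleton w s ih =>
    have hmem := hw w (List.prefix_append _ _)
    have hmem' := hw _ (List.prefix_refl _)
    have hstep : act (act v (wordProd S w)) (s : G) = act v (wordProd S (w ++ [s])) := by
      rw [hact_mul, wordProd_concat]
    rw [← (hψ.2.2 _ hmem _ hmem' s).1 hstep,
      ih fun x hx => hw x (hx.trans (List.prefix_append _ _)), hact_mul, wordProd_concat]

theorem map_act_of_length_le (hψ : IsBallEmbedding act S v v' R R' ψ)
    (hact_one : ∀ v : V, act v 1 = v)
    (hact_mul : ∀ (v : V) (g h : G), act (act v g) h = act v (g * h)) {w : List S}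
    (hw : w.length ≤ R) :
    ψ (act v (wordProd S w)) = act (ψ v) (wordProd S w) :=
  hψ.map_act hact_one hact_mul w fun x hx => ⟨x, hx.length_le.trans hw, rfl⟩

theorem bijOn_ball (hψ : IsBallEmbedding act S v v' R R' ψ) (hact_one : ∀ v : V, act v 1 = v)
    (hact_mul : ∀ (v : V) (g h : G), act (act v g) h = act v (g * h)) {k : ℕ} (hk : k ≤ R) :
    Set.BijOn ψ (ball act S v k) (ball act S (ψ v) k) := by
  refine ⟨?_, hψ.1.mono (ball_mono act S v hk), ?_⟩
  · rintro _ ⟨w, hw, rfl⟩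
    exact ⟨w, hw, (hψ.map_act_of_length_le hact_one hact_mul (hw.trans hk)).symm⟩
  · rintro _ ⟨w, hw, rfl⟩
    exact ⟨_, ⟨w, hw, rfl⟩, hψ.map_act_of_length_le hact_one hact_mul (hw.trans hk)⟩

theorem gdist_map (hψ : IsBallEmbedding act S v v' R R' ψ) (hact_one : ∀ v : V, act v 1 = v)
    (hact_mul : ∀ (v : V) (g h : G), act (act v g) h = act v (g * h)) {u : V}
    (hu : u ∈ ball act S v R) :
    gdist act S (ψ v) (ψ u) = gdist act S v u := by
  have hle : gdist act S (ψ v) (ψ u) ≤ gdist act S v u :=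
    gdist_le ((hψ.bijOn_ball hact_one hact_mul (gdist_le hu)).mapsTo (mem_ball_gdist hu))
  refine le_antisymm hle ?_
  have hR : gdist act S (ψ v) (ψ u) ≤ R := hle.trans (gdist_le hu)
  obtain ⟨x, hx, hxu⟩ := (hψ.bijOn_ball hact_one hact_mul hR).surjOn
    (mem_ball_gdist ((hψ.bijOn_ball hact_one hact_mul le_rfl).mapsTo hu))
  obtain rfl := hψ.1 (ball_mono act S v hR hx) hu hxu
  exact gdist_le hx

/-- An embedding of a ball containing the path labeled `w` identifies the corresponding
elements of the portrait of `w`. -/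
theorem portraitRel (hψ : IsBallEmbedding act S v v' R R' ψ) (hact_one : ∀ v : V, act v 1 = v)
    (hact_mul : ∀ (v : V) (g h : G), act (act v g) h = act v (g * h)) {w : List S}
    (hw : rad act S w v ≤ R) : PortraitRel act S w v (ψ v) := by
  have htake (i : ℕ) : act v (wordProd S (w.take i)) ∈ ball act S v R :=
    ball_mono act S v hw (act_take_mem_ball act S w v i)
  have hmap (i : ℕ) :
      ψ (act v (wordProd S (w.take i))) = act (ψ v) (wordProd S (w.take i)) := by
    refine hψ.map_act hact_one hact_mul _ fun x hx => ?_
    rw [List.prefix_iff_eq_take.1 (hx.trans ⟨w.drop i, List.take_append_drop i w⟩)]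
    exact htake _
  have hrad : rad act S w (ψ v) = rad act S w v :=
    Finset.sup_congr rfl fun i _ => by
      rw [← hmap, hψ.gdist_map hact_one hact_mul (htake i)]
  refine ⟨ψ, ?_, rfl, ?_, fun x hx y hy s =>
    hψ.2.2 x (ball_mono act S v hw hx) y (ball_mono act S v hw hy) s⟩
  · rw [hrad]
    exact hψ.bijOn_ball hact_one hact_mul hw
  · simpa using hmap w.length

end IsBallEmbedding

/-- If the number of indices with `n i ≤ m` is at most `K * m`, then the
`p₁`-norm is controlled by the `p₂`-norm. -/
theorem sum_rpow_comparison {ι : Type*} [Fintype ι] (n : ι → ℝ) (hn : ∀ i, 1 ≤ n i)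
    {K p₁ p₂ : ℝ} (hK : 0 ≤ K) (hp₁ : 1 ≤ p₁) (hp₁₂ : p₁ < p₂)
    (hcount : ∀ m : ℝ, 1 ≤ m → ((Finset.univ.filter fun i => n i ≤ m).card : ℝ) ≤ K * m) :
    (∑ i, n i ^ (p₁ - 1)) ^ (1 / p₁) ≤ (K + 1) * (∑ i, n i ^ (p₂ - 1)) ^ (1 / p₂) := by
  have hp₁0 : 0 < p₁ := by linarith
  have hp₂0 : 0 < p₂ := by linarith
  rcases isEmpty_or_nonempty ι with hι | ⟨⟨i₀⟩⟩
  · simp [Real.zero_rpow, hp₁0.ne', hp₂0.ne']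
  set f := ∑ i, n i ^ (p₂ - 1) with hf
  set T := f ^ (1 / p₂) with hTdef
  have hf1 : 1 ≤ f :=
    (Real.one_le_rpow (hn i₀) (by linarith)).trans
      (Finset.single_le_sum (f := fun i => n i ^ (p₂ - 1))
        (fun i _ => Real.rpow_nonneg (by linarith [hn i]) _) (Finset.mem_univ i₀))
  have hT1 : 1 ≤ T := Real.one_le_rpow hf1 (by positivity)
  have hT0 : 0 < T := by linarith
  have hTf : T ^ p₂ = f := by
    rw [hTdef, ← Real.rpow_mul (by linarith), one_div_mul_cancel hp₂0.ne', Real.rpow_one]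
  have hsmall : ∑ i with n i ≤ T, n i ^ (p₁ - 1) ≤ K * T ^ p₁ := by
    calc ∑ i with n i ≤ T, n i ^ (p₁ - 1)
        ≤ ∑ i with n i ≤ T, T ^ (p₁ - 1) := Finset.sum_le_sum fun i hi =>
          Real.rpow_le_rpow (by linarith [hn i]) (Finset.mem_filter.1 hi).2 (by linarith)
      _ = ((Finset.univ.filter fun i => n i ≤ T).card : ℝ) * T ^ (p₁ - 1) := by
          rw [Finset.sum_const, nsmul_eq_mul]
      _ ≤ K * T * T ^ (p₁ - 1) := by
          gcongr
          exact hcount T hT1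
      _ = K * T ^ p₁ := by
          rw [Real.rpow_sub_one hT0.ne']
          field_simp
  have hlarge : ∑ i with ¬ n i ≤ T, n i ^ (p₁ - 1) ≤ T ^ p₁ := by
    calc ∑ i with ¬ n i ≤ T, n i ^ (p₁ - 1)
        ≤ ∑ i with ¬ n i ≤ T, n i ^ (p₂ - 1) * T ^ (p₁ - p₂) := Finset.sum_le_sum fun i hi => by
          have hi' : T ≤ n i := (not_le.1 (Finset.mem_filter.1 hi).2).le
          have hi0 : 0 < n i := by linarith [hn i]
          rw [show p₁ - 1 = (p₂ - 1) + (p₁ - p₂) by ring, Real.rpow_add hi0]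
          exact mul_le_mul_of_nonneg_left
            (Real.rpow_le_rpow_of_nonpos hT0 hi' (by linarith)) (by positivity)
      _ = (∑ i with ¬ n i ≤ T, n i ^ (p₂ - 1)) * T ^ (p₁ - p₂) := by rw [Finset.sum_mul]
      _ ≤ f * T ^ (p₁ - p₂) := by
          gcongr
          exact Finset.sum_le_sum_of_subset_of_nonneg (Finset.filter_subset _ _)
            fun i _ _ => Real.rpow_nonneg (by linarith [hn i]) _
      _ = T ^ p₁ := by
          rw [← hTf, ← Real.rpow_add hT0]
          ring_nf
  have htotal : ∑ i, n i ^ (p₁ - 1) ≤ (K + 1) * T ^ p₁ := by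
    rw [← Finset.sum_filter_add_sum_filter_not Finset.univ fun i => n i ≤ T]
    linarith
  calc (∑ i, n i ^ (p₁ - 1)) ^ (1 / p₁)
      ≤ ((K + 1) * T ^ p₁) ^ (1 / p₁) :=
        Real.rpow_le_rpow
          (Finset.sum_nonneg fun i _ => Real.rpow_nonneg (by linarith [hn i]) _) htotal
          (by positivity)
    _ = (K + 1) ^ (1 / p₁) * T := by
        rw [Real.mul_rpow (by linarith) (by positivity), ← Real.rpow_mul hT0.le,
          mul_one_div_cancel hp₁0.ne', Real.rpow_one]
    _ ≤ (K + 1) * T := by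
        gcongr
        calc (K + 1) ^ (1 / p₁) ≤ (K + 1) ^ (1 : ℝ) :=
              Real.rpow_le_rpow_of_exponent_le (by linarith) ((div_le_one hp₁0).2 hp₁)
          _ = K + 1 := Real.rpow_one _

theorem finite_ball {act : V → G → V} {S : Set G} {C d : ℝ} (hC : 1 ≤ C)
    (hball : ∀ (v : V) (R : ℕ), 1 ≤ R →
      C⁻¹ * (R : ℝ) ^ d ≤ (Nat.card (ball act S v R) : ℝ)) (v : V) (R : ℕ) :
    (ball act S v R).Finite := by
  refine Set.Finite.subset ?_ (ball_mono act S v R.le_succ)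
  have h := hball v (R + 1) (by omega)
  have hpos : (0 : ℝ) < Nat.card (ball act S v (R + 1)) := lt_of_lt_of_le (by positivity) h
  exact Nat.finite_of_card_ne_zero (Nat.cast_pos.1 hpos).ne'

/-- A portrait has at most as many elements of radius at most `R` as there are vertices
in a ball into which every ball of radius `R` embeds. -/
theorem card_portrait_le {act : V → G → V} {S : Set G} (hact_one : ∀ v : V, act v 1 = v)
    (hact_mul : ∀ (v : V) (g h : G), act (act v g) h = act v (g * h)) {v₀ : V} {R R' : ℕ}
    (hfin : (ball act S v₀ R').Finite)
    (hemb : ∀ v : V, ∃ ψ : V → V, IsBallEmbedding act S v v₀ R R' ψ) (w : List S)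
    (A : Finset (Quot (PortraitRel act S w))) (hA : ∀ q ∈ A, rad act S w (Quot.out q) ≤ R) :
    A.card ≤ Nat.card (ball act S v₀ R') := by
  choose ψ hψ using hemb
  have hout (q) (hq : q ∈ A) : Quot.mk _ (ψ (Quot.out q) (Quot.out q)) = q := by
    rw [← Quot.sound ((hψ (Quot.out q)).portraitRel hact_one hact_mul (hA q hq)), Quot.out_eq]
  rw [Nat.card_coe_set_eq, ← Set.ncard_coe_finset]
  refine Set.ncard_le_ncard_of_injOn (fun q => ψ (Quot.out q) (Quot.out q)) ?_ ?_ hfin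
  · intro q _
    exact (hψ _).2.1 (mem_ball_self hact_one S _ _)
  · intro q hq q' hq' h
    rw [← hout q hq, ← hout q' hq']
    exact congrArg (Quot.mk _) h

theorem Np_comparison {act : V → G → V} {S : Set G} (hact_one : ∀ v : V, act v 1 = v)
    (hact_mul : ∀ (v : V) (g h : G), act (act v g) h = act v (g * h))
    {C d : ℝ} (hC : 1 ≤ C) (hd : 1 ≤ d)
    (hball : ∀ (v : V) (R : ℕ), 1 ≤ R →
      C⁻¹ * (R : ℝ) ^ d ≤ (Nat.card (ball act S v R) : ℝ) ∧
      (Nat.card (ball act S v R) : ℝ) ≤ C * (R : ℝ) ^ d)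
    {L : ℝ} (hL : 1 < L)
    (hrep : ∀ (v v' : V) (R : ℕ), 0 < R → ∃ ψ : V → V,
      IsBallEmbedding act S v v' R ⌊L * (R : ℝ)⌋₊ ψ)
    {p₁ p₂ : ℝ} (hp₁ : 1 ≤ p₁) (hp₁₂ : p₁ < p₂) (w : List S) :
    Np act S w p₁ ≤ (C * L ^ d * C + 1) * Np act S w p₂ := by
  have hfin := finite_ball hC fun v R hR => (hball v R hR).1
  have hone (v : V) (R : ℕ) : (1 : ℝ) ≤ Nat.card (ball act S v R) := by
    have := (hfin v R).to_subtype
    have : Nonempty (ball act S v R) := ⟨⟨v, mem_ball_self hact_one S v R⟩⟩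
    exact_mod_cast Nat.card_pos
  unfold Np Npow
  rcases finite_or_infinite (Quot (PortraitRel act S w)) with hQ | hQ
  swap
  · have hzero (p : ℝ) (hp : 1 ≤ p) : (∑' q : Quot (PortraitRel act S w),
        (Nat.card (ball act S (Quot.out q) (rad act S w (Quot.out q))) : ℝ) ^ (p - 1)) = 0 := by
      refine tsum_eq_zero_of_not_summable fun hs => ?_
      refine (summable_const_iff (1 : ℝ)).not.2 one_ne_zero
        (Summable.of_nonneg_of_le (β := Quot (PortraitRel act S w)) (fun _ => zero_le_one)
          (fun q => Real.one_le_rpow (hone _ _) (by linarith)) hs)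
    rw [hzero p₁ hp₁, hzero p₂ (by linarith), Real.zero_rpow (by positivity),
      Real.zero_rpow (one_div_ne_zero (by linarith)), mul_zero]
  have := Fintype.ofFinite (Quot (PortraitRel act S w))
  rw [tsum_fintype, tsum_fintype]
  refine sum_rpow_comparison _ (fun q => hone _ _) (by positivity) hp₁ hp₁₂ fun m hm => ?_
  set A := Finset.univ.filter fun q : Quot (PortraitRel act S w) =>
    (Nat.card (ball act S (Quot.out q) (rad act S w (Quot.out q))) : ℝ) ≤ m with hA
  rcases A.eq_empty_or_nonempty with hAe | ⟨q₀, hq₀⟩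
  · rw [hAe, Finset.card_empty, Nat.cast_zero]
    positivity
  obtain ⟨q, hq, hmax⟩ := A.exists_max_image (fun q => rad act S w (Quot.out q)) ⟨q₀, hq₀⟩
  set R := max (rad act S w (Quot.out q)) 1 with hR
  have hR1 : 1 ≤ R := le_max_right _ _
  have hRd : (R : ℝ) ^ d ≤ C * m := by
    rcases Nat.eq_zero_or_pos (rad act S w (Quot.out q)) with h0 | hpos
    · rw [hR, h0]
      simpa using one_le_mul_of_one_le_of_one_le hC hm
    · rw [hR, max_eq_left hpos, ← inv_mul_le_iff₀ (by linarith)]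
      exact (hball _ _ hpos).1.trans (Finset.mem_filter.1 hq).2
  have hR1' : (1 : ℝ) ≤ R := by exact_mod_cast hR1
  have hcard := card_portrait_le hact_one hact_mul (hfin (Quot.out q) ⌊L * (R : ℝ)⌋₊)
    (fun v => hrep v (Quot.out q) R hR1) w A fun q' hq' => (hmax q' hq').trans (le_max_left _ _)
  calc (A.card : ℝ) ≤ Nat.card (ball act S (Quot.out q) ⌊L * (R : ℝ)⌋₊) := by exact_mod_cast hcard
    _ ≤ C * (⌊L * (R : ℝ)⌋₊ : ℝ) ^ d :=
        (hball _ _ (Nat.le_floor (by push_cast; nlinarith))).2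
    _ ≤ C * (L * R) ^ d := by
        gcongr
        exact Nat.floor_le (by positivity)
    _ = C * L ^ d * (R : ℝ) ^ d := by
        rw [Real.mul_rpow (by linarith) (by linarith), mul_assoc]
    _ ≤ C * L ^ d * (C * m) := by gcongr
    _ = C * L ^ d * C * m := by ring

/-- Under conditions (1) and (2) on `Γ`, for all `1 ≤ p₁ < p₂`
there exists a constant `C_{p₁,p₂}` such that `N_{p₁}(g) ≤ C_{p₁,p₂}·N_{p₂}(g)`
for all `g ∈ G`. -/
theorem Npg_comparison
    (S : Set G) (hSfin : S.Finite) (hSsym : ∀ s ∈ S, s⁻¹ ∈ S)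
    (hSgen : Subgroup.closure S = ⊤)
    (act : V → G → V)
    (hact_one : ∀ v : V, act v 1 = v)
    (hact_mul : ∀ (v : V) (g h : G), act (act v g) h = act v (g * h))
    (hfaithful : ∀ g : G, (∀ v : V, act v g = v) → g = 1)
    (htrans : ∀ u v : V, ∃ g : G, act u g = v)
    -- condition (1): polynomial growth of the balls
    (C d : ℝ) (hC : 1 ≤ C) (hd : 1 ≤ d)
    (hball : ∀ (v : V) (R : ℕ), 1 ≤ R →
      C⁻¹ * (R : ℝ) ^ d ≤ (Nat.card (ball act S v R) : ℝ) ∧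
      (Nat.card (ball act S v R) : ℝ) ≤ C * (R : ℝ) ^ d)
    -- condition (2): linear repetitivity
    (L : ℝ) (hL : 1 < L)
    (hrep : ∀ (v v' : V) (R : ℕ), 0 < R → ∃ ψ : V → V,
      IsBallEmbedding act S v v' R ⌊L * (R : ℝ)⌋₊ ψ)
    (p₁ p₂ : ℝ) (hp₁ : 1 ≤ p₁) (hp₁₂ : p₁ < p₂) :
    ∃ Cp : ℝ, ∀ g : G, Npg act S g p₁ ≤ Cp * Npg act S g p₂ := by
  have hK : 0 < C * L ^ d * C + 1 := by positivity
  refine ⟨C * L ^ d * C + 1, fun g => ?_⟩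
  unfold Npg
  by_cases hg : ∃ w : List S, wordProd S w = g
  · obtain ⟨w₀, hw₀⟩ := hg
    rw [← div_le_iff₀' hK]
    refine le_csInf ⟨_, w₀, hw₀, rfl⟩ ?_
    rintro _ ⟨w, hw, rfl⟩
    rw [div_le_iff₀' hK]
    refine le_trans (csInf_le ⟨0, ?_⟩ ⟨w, hw, rfl⟩)
      (Np_comparison hact_one hact_mul hC hd hball hL hrep hp₁ hp₁₂ w)
    rintro _ ⟨x, -, rfl⟩
    exact Real.rpow_nonneg (tsum_nonneg fun q => Real.rpow_nonneg (Nat.cast_nonneg _) _) _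
  · have hempty (p : ℝ) : {x : ℝ | ∃ w : List S, wordProd S w = g ∧ Np act S w p = x} = ∅ :=
      Set.eq_empty_of_forall_notMem fun _ ⟨w, hw, _⟩ => hg ⟨w, hw⟩
    rw [hempty, hempty, Real.sInf_empty, mul_zero]

end ActionGrowth
end
end

section
/- Let Γ be the graph of a faithful transitive right action of a group G generated by a finite symmetric set S, satisfying conditions (1) and (2). Then for every p ≥ 1 there exists K > 0 such that the growth of G satisfies γ_G(R) ≤ R^{K·N_p(R)} for all R ≥ 2. -/
noncomputable section

namespace ActionGrowth

variable {G V : Type} [Group G]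

section Words

variable {S : Set G} {act : V → G → V}

/-- The path labeled `t` starting at `x` stays in the ball of radius `r` around `x`. -/
def Stays (act : V → G → V) (S : Set G) (r : ℕ) (x : V) (t : List S) : Prop :=
  ∀ q : List S, q <+: t → act x (wordProd S q) ∈ ball act S x r

/-- Whenever two paths from `x` inside its ball of radius `r` have the same endpoint, so do
the paths from `y` with the same labels. -/
def LocalHom (act : V → G → V) (S : Set G) (r : ℕ) (x y : V) : Prop :=
  ∀ t t' : List S, Stays act S r x t → Stays act S r x t' →
    act x (wordProd S t) = act x (wordProd S t') →
    act y (wordProd S t) = act y (wordProd S t')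

lemma act_wordProd_concat (hact_mul : ∀ (v : V) (g h : G), act (act v g) h = act v (g * h))
    (x : V) (t : List S) (s : S) :
    act x (wordProd S (t ++ [s])) = act (act x (wordProd S t)) (s : G) := by
  simp [wordProd, hact_mul]

lemma ball_mono_s7 (x : V) {r r' : ℕ} (h : r ≤ r') : ball act S x r ⊆ ball act S x r' := by
  rintro _ ⟨w, hw, rfl⟩
  exact ⟨w, hw.trans h, rfl⟩

lemma ball_finite (hS : S.Finite) (x : V) (r : ℕ) : (ball act S x r).Finite := by
  have := hS.to_subtype
  refine ((List.finite_length_le S r).image fun w => act x (wordProd S w)).subset ?_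
  rintro _ ⟨w, hw, rfl⟩
  exact ⟨w, hw, rfl⟩

lemma ballG_finite (hS : S.Finite) (r : ℕ) : (ballG S r).Finite := by
  have := hS.to_subtype
  refine ((List.finite_length_le S r).image fun w => wordProd S w).subset ?_
  rintro _ ⟨w, hw, rfl⟩
  exact ⟨w, hw, rfl⟩

lemma self_mem_ball (hact_one : ∀ v : V, act v 1 = v) (x : V) (r : ℕ) : x ∈ ball act S x r :=
  ⟨[], by simp, by simp [wordProd, hact_one]⟩

lemma one_le_card_ball (hS : S.Finite) (hact_one : ∀ v : V, act v 1 = v) (x : V) (r : ℕ) :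
    1 ≤ Nat.card (ball act S x r) := by
  have := (ball_finite (act := act) hS x r).to_subtype
  have : Nonempty (ball act S x r) := ⟨⟨x, self_mem_ball hact_one x r⟩⟩
  exact Nat.card_pos

lemma gdist_le_iff (x : V) (t : List S) (n : ℕ) :
    gdist act S x (act x (wordProd S t)) ≤ n ↔ act x (wordProd S t) ∈ ball act S x n := by
  constructor
  · intro h
    have hne : {n | act x (wordProd S t) ∈ ball act S x n}.Nonempty := ⟨t.length, t, le_rfl, rfl⟩
    exact ball_mono_s7 x h (Nat.sInf_mem hne)
  · exact fun h => Nat.sInf_le h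

lemma rad_le_iff (x : V) (t : List S) (n : ℕ) : rad act S t x ≤ n ↔ Stays act S n x t := by
  simp only [rad, Finset.sup_le_iff, gdist_le_iff, Finset.mem_range]
  constructor
  · intro h q hq
    rw [List.prefix_iff_eq_take.1 hq]
    exact h _ (Nat.lt_succ_of_le hq.length_le)
  · exact fun h i _ => h _ (List.take_prefix _ _)

lemma stays_rad (x : V) (t : List S) : Stays act S (rad act S t x) x t :=
  (rad_le_iff x t _).1 le_rfl

lemma Stays.mono {r r' : ℕ} (h : r ≤ r') {x : V} {t : List S} (ht : Stays act S r x t) :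
    Stays act S r' x t := fun q hq => ball_mono_s7 x h (ht q hq)

lemma Stays.initial {r : ℕ} {x : V} {q t : List S} (ht : Stays act S r x t) (hq : q <+: t) :
    Stays act S r x q := fun q' hq' => ht q' (hq'.trans hq)

lemma Stays.mem {r : ℕ} {x : V} {t : List S} (ht : Stays act S r x t) :
    act x (wordProd S t) ∈ ball act S x r := ht t List.prefix_rfl

lemma stays_of_length_le {r : ℕ} (x : V) {t : List S} (h : t.length ≤ r) :
    Stays act S r x t := fun q hq => ⟨q, hq.length_le.trans h, rfl⟩

lemma stays_concat {r : ℕ} {x : V} {t : List S} {s : S} :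
    Stays act S r x (t ++ [s]) ↔
      Stays act S r x t ∧ act x (wordProd S (t ++ [s])) ∈ ball act S x r := by
  refine ⟨fun h => ⟨h.initial (List.prefix_append _ _), h.mem⟩, fun h q hq => ?_⟩
  rcases List.prefix_concat_iff.1 hq with rfl | hq
  · exact h.2
  · exact h.1 q hq

lemma LocalHom.mono {r r' : ℕ} (h : r ≤ r') {x y : V} (hxy : LocalHom act S r' x y) :
    LocalHom act S r x y := fun t t' ht ht' => hxy t t' (ht.mono h) (ht'.mono h)

lemma LocalHom.stays {r : ℕ} {x y : V} (hxy : LocalHom act S r x y) {t : List S}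
    (ht : Stays act S r x t) : Stays act S r y t := by
  intro q hq
  obtain ⟨w, hw, hwq⟩ := ht q hq
  exact ⟨w, hw, hxy w q (stays_of_length_le x hw) (ht.initial hq) hwq⟩

lemma LocalHom.trans {r : ℕ} {x y z : V} (hxy : LocalHom act S r x y)
    (hyz : LocalHom act S r y z) : LocalHom act S r x z :=
  fun t t' ht ht' h => hyz t t' (hxy.stays ht) (hxy.stays ht') (hxy t t' ht ht' h)

lemma LocalHom.rad_le {r : ℕ} {x y : V} (hxy : LocalHom act S r x y) {w : List S}
    (hw : rad act S w x ≤ r) : rad act S w y ≤ rad act S w x :=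
  (rad_le_iff _ _ _).2 ((hxy.mono hw).stays (stays_rad x w))

lemma rad_eq_of_localHom {r : ℕ} {x y : V} (hxy : LocalHom act S r x y)
    (hyx : LocalHom act S r y x) {w : List S} (hw : rad act S w x ≤ r) :
    rad act S w y = rad act S w x :=
  le_antisymm (hxy.rad_le hw) (hyx.rad_le ((hxy.rad_le hw).trans hw))

lemma map_act_of_stays (hact_one : ∀ v : V, act v 1 = v)
    (hact_mul : ∀ (v : V) (g h : G), act (act v g) h = act v (g * h))
    {r : ℕ} {x : V} {φ : V → V}
    (hφ : ∀ a ∈ ball act S x r, ∀ b ∈ ball act S x r, ∀ s : S,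
      act a (s : G) = b → act (φ a) (s : G) = φ b)
    {t : List S} (ht : Stays act S r x t) :
    φ (act x (wordProd S t)) = act (φ x) (wordProd S t) := by
  induction t using List.reverseRecOn with
  | nil => simp [wordProd, hact_one]
  | append_singleton t s ih =>
    have h := stays_concat.1 ht
    rw [act_wordProd_concat hact_mul (φ x), ← ih h.1]
    exact (hφ _ h.1.mem _ h.2 s (act_wordProd_concat hact_mul x t s).symm).symm

/-- A rooted isomorphic embedding of labeled balls yields local homomorphisms in both
directions. -/
lemma localHom_of_embedding (hact_one : ∀ v : V, act v 1 = v)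
    (hact_mul : ∀ (v : V) (g h : G), act (act v g) h = act v (g * h))
    {r : ℕ} {x : V} {φ : V → V} (hinj : Set.InjOn φ (ball act S x r))
    (hφ : ∀ a ∈ ball act S x r, ∀ b ∈ ball act S x r, ∀ s : S,
      (act a (s : G) = b ↔ act (φ a) (s : G) = φ b)) :
    LocalHom act S r x (φ x) ∧ LocalHom act S r (φ x) x := by
  have hmap {t : List S} (ht : Stays act S r x t) :=
    map_act_of_stays hact_one hact_mul (fun a ha b hb s => (hφ a ha b hb s).1) ht
  have hpull {t : List S} (ht : Stays act S r (φ x) t) : Stays act S r x t := by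
    induction t using List.reverseRecOn with
    | nil => exact stays_of_length_le x (by simp)
    | append_singleton t s ih =>
      obtain ⟨ht, q, hq, hqt⟩ := stays_concat.1 ht
      have hq' := stays_of_length_le (act := act) x hq
      refine stays_concat.2 ⟨ih ht, q, hq, ?_⟩
      rw [act_wordProd_concat hact_mul]
      refine ((hφ _ (ih ht).mem _ hq'.mem s).2 ?_).symm
      rw [hmap (ih ht), hmap hq', hqt, act_wordProd_concat hact_mul]
  refine ⟨fun t t' ht ht' h => ?_, fun t t' ht ht' h => ?_⟩
  · rw [← hmap ht, ← hmap ht', h]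
  · refine hinj (hpull ht).mem (hpull ht').mem ?_
    rw [hmap (hpull ht), hmap (hpull ht'), h]

lemma localHom_of_portraitRel (hact_one : ∀ v : V, act v 1 = v)
    (hact_mul : ∀ (v : V) (g h : G), act (act v g) h = act v (g * h))
    {w : List S} {x y : V} (h : PortraitRel act S w x y) :
    rad act S w y = rad act S w x ∧ LocalHom act S (rad act S w x) x y ∧
      LocalHom act S (rad act S w x) y x := by
  obtain ⟨φ, hbij, rfl, -, hφ⟩ := h
  have h := localHom_of_embedding hact_one hact_mul hbij.injOn hφ
  exact ⟨rad_eq_of_localHom h.1 h.2 le_rfl, h⟩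

lemma localHom_of_quot_eq (hact_one : ∀ v : V, act v 1 = v)
    (hact_mul : ∀ (v : V) (g h : G), act (act v g) h = act v (g * h))
    {w : List S} {x y : V}
    (h : Quot.mk (PortraitRel act S w) x = Quot.mk (PortraitRel act S w) y) :
    rad act S w y = rad act S w x ∧ LocalHom act S (rad act S w x) x y ∧
      LocalHom act S (rad act S w x) y x := by
  replace h := Quot.eqvGen_exact h
  induction h with
  | rel x y h => exact localHom_of_portraitRel hact_one hact_mul h
  | refl x => exact ⟨rfl, fun _ _ _ _ h => h, fun _ _ _ _ h => h⟩
  | symm x y h ih =>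
    rw [ih.1]
    exact ⟨rfl, ih.2.2, ih.2.1⟩
  | trans x y z h h' ih ih' =>
    rw [ih.1] at ih'
    exact ⟨ih'.1, ih.2.1.trans ih'.2.1, ih'.2.2.trans ih.2.2⟩

lemma portraitRel_of_localHom (hact_one : ∀ v : V, act v 1 = v)
    (hact_mul : ∀ (v : V) (g h : G), act (act v g) h = act v (g * h))
    {r : ℕ} {x y : V} (hxy : LocalHom act S r x y) (hyx : LocalHom act S r y x)
    {w : List S} (hw : rad act S w x ≤ r) : PortraitRel act S w x y := by
  have hrad := rad_eq_of_localHom hxy hyx hw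
  have hstay := stays_rad (act := act) x w
  unfold PortraitRel
  rw [hrad]
  replace hxy := hxy.mono hw
  replace hyx := hyx.mono hw
  generalize rad act S w x = ρ at *
  have hch : ∀ z : V, ∃ q : List S,
      z ∈ ball act S x ρ → q.length ≤ ρ ∧ act x (wordProd S q) = z := by
    intro z
    by_cases hz : z ∈ ball act S x ρ
    · obtain ⟨q, hq⟩ := hz
      exact ⟨q, fun _ => hq⟩
    · exact ⟨[], fun h => absurd h hz⟩
  choose q hq using hch
  have hφ {t : List S} (ht : Stays act S ρ x t) :
      act y (wordProd S (q (act x (wordProd S t)))) = act y (wordProd S t) :=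
    hxy _ _ (stays_of_length_le x (hq _ ht.mem).1) ht (hq _ ht.mem).2
  refine ⟨fun z => act y (wordProd S (q z)), ⟨?_, ?_, ?_⟩, ?_, hφ hstay, ?_⟩
  · exact fun z hz => ⟨q z, (hq z hz).1, rfl⟩
  · intro z hz z' hz' h
    rw [← (hq z hz).2, ← (hq z' hz').2]
    exact hyx _ _ (stays_of_length_le y (hq z hz).1) (stays_of_length_le y (hq z' hz').1) h
  · rintro _ ⟨t, ht, rfl⟩
    have ht' := stays_of_length_le (act := act) x ht
    exact ⟨act x (wordProd S t), ht'.mem, hφ ht'⟩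
  · have := hφ (stays_of_length_le x (Nat.zero_le ρ) : Stays act S ρ x [])
    simpa [wordProd, hact_one] using this
  · intro a ha b hb s
    have ha' := hq a ha
    have hb' := hq b hb
    have hsx := stays_of_length_le (act := act) x ha'.1
    have hsy := stays_of_length_le (act := act) y ha'.1
    have htx := stays_of_length_le (act := act) x hb'.1
    have hty := stays_of_length_le (act := act) y hb'.1
    constructor
    · intro h
      have hc : act x (wordProd S (q a ++ [s])) = act x (wordProd S (q b)) := by
        rw [act_wordProd_concat hact_mul, ha'.2, hb'.2, h]
      have := hxy _ _ (stays_concat.2 ⟨hsx, hc ▸ htx.mem⟩) htx hc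
      rwa [act_wordProd_concat hact_mul] at this
    · intro h
      have hc : act y (wordProd S (q a ++ [s])) = act y (wordProd S (q b)) := by
        rw [act_wordProd_concat hact_mul]
        exact h
      have := hyx _ _ (stays_concat.2 ⟨hsy, hc ▸ hty.mem⟩) hty hc
      rwa [act_wordProd_concat hact_mul, ha'.2, hb'.2] at this

/-- The isomorphism type of every ball of radius `n` around a vertex is realized inside
a fixed ball, provided all such balls embed into it. -/
lemma exists_local_model (hact_one : ∀ v : V, act v 1 = v)
    (hact_mul : ∀ (v : V) (g h : G), act (act v g) h = act v (g * h)) {v₀ : V} {n m : ℕ}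
    (hrep : ∀ v : V, ∃ ψ : V → V, IsBallEmbedding act S v v₀ n m ψ) :
    ∃ c : V → V, ∀ u, c u ∈ ball act S v₀ m ∧ LocalHom act S n u (c u) ∧
      LocalHom act S n (c u) u := by
  choose ψ hψ using hrep
  exact ⟨fun u => ψ u u, fun u => ⟨(hψ u).2.1 (self_mem_ball hact_one u n),
    localHom_of_embedding hact_one hact_mul (hψ u).1 (hψ u).2.2⟩⟩

lemma ncard_portrait_rad_le (hS : S.Finite) (hact_one : ∀ v : V, act v 1 = v)
    (hact_mul : ∀ (v : V) (g h : G), act (act v g) h = act v (g * h)) {v₀ : V} {n m : ℕ}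
    (hrep : ∀ v : V, ∃ ψ : V → V, IsBallEmbedding act S v v₀ n m ψ) (w : List S) :
    {q : Quot (PortraitRel act S w) | rad act S w q.out ≤ n}.Finite ∧
      {q : Quot (PortraitRel act S w) | rad act S w q.out ≤ n}.ncard ≤
        Nat.card (ball act S v₀ m) := by
  obtain ⟨c, hc⟩ := exists_local_model hact_one hact_mul hrep
  have hmaps : Set.MapsTo (fun q => c q.out)
      {q : Quot (PortraitRel act S w) | rad act S w q.out ≤ n} (ball act S v₀ m) :=
    fun q _ => (hc q.out).1
  have hinj : Set.InjOn (fun q => c q.out)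
      {q : Quot (PortraitRel act S w) | rad act S w q.out ≤ n} := by
    intro q hq q' hq' h
    dsimp only at h
    rw [← Quot.out_eq q, ← Quot.out_eq q']
    refine Quot.sound (portraitRel_of_localHom hact_one hact_mul (r := n) ?_ ?_ hq)
    · exact (hc q.out).2.1.trans (h ▸ (hc q'.out).2.2)
    · exact (hc q'.out).2.1.trans (h ▸ (hc q.out).2.2)
  refine ⟨Set.Finite.of_injOn hmaps hinj (ball_finite hS v₀ m), ?_⟩
  rw [Nat.card_coe_set_eq]
  exact Set.ncard_le_ncard_of_injOn _ hmaps hinj (ball_finite hS v₀ m)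

lemma finite_portrait (hS : S.Finite) (hact_one : ∀ v : V, act v 1 = v)
    (hact_mul : ∀ (v : V) (g h : G), act (act v g) h = act v (g * h)) {L : ℝ}
    (hrep : ∀ (v v' : V) (R : ℕ), 0 < R → ∃ ψ : V → V,
      IsBallEmbedding act S v v' R ⌊L * (R : ℝ)⌋₊ ψ) (w : List S) :
    Finite (Quot (PortraitRel act S w)) := by
  rcases isEmpty_or_nonempty V with hV | ⟨⟨v₀⟩⟩
  · have : IsEmpty (Quot (PortraitRel act S w)) := ⟨fun q => hV.elim q.out⟩
    infer_instance
  · have h := (ncard_portrait_rad_le hS hact_one hact_mul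
      (fun v => hrep v v₀ (w.length + 1) (Nat.succ_pos _)) w).1
    exact Set.finite_univ_iff.1 (h.subset fun q _ =>
      (rad_le_iff _ _ _).2 (stays_of_length_le _ (Nat.le_succ _)))

lemma Np_nonneg (w : List S) (p : ℝ) : 0 ≤ Np act S w p :=
  Real.rpow_nonneg (tsum_nonneg fun _ => Real.rpow_nonneg (Nat.cast_nonneg _) _) _

lemma Npg_nonneg (g : G) (p : ℝ) : 0 ≤ Npg act S g p :=
  Real.sInf_nonneg (by rintro _ ⟨w, -, rfl⟩; exact Np_nonneg w p)

lemma NpR_nonneg (R : ℕ) (p : ℝ) : 0 ≤ NpR act S R p :=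
  Real.sSup_nonneg (by rintro _ ⟨g, -, rfl⟩; exact Npg_nonneg g p)

lemma Npg_le_NpR (hS : S.Finite) {R : ℕ} {g : G} (hg : g ∈ ballG S R) (p : ℝ) :
    Npg act S g p ≤ NpR act S R p :=
  le_csSup (((ballG_finite hS R).image fun g => Npg act S g p).bddAbove) ⟨g, hg, rfl⟩

lemma one_le_Npow [Nonempty V] (hS : S.Finite) (hact_one : ∀ v : V, act v 1 = v)
    (w : List S) [Finite (Quot (PortraitRel act S w))] {p : ℝ} (hp : 1 ≤ p) :
    1 ≤ Npow act S w p := by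
  cases nonempty_fintype (Quot (PortraitRel act S w))
  let q : Quot (PortraitRel act S w) := Quot.mk _ (Classical.arbitrary V)
  rw [Npow, tsum_fintype]
  refine le_trans ?_ (Finset.single_le_sum (fun _ _ => Real.rpow_nonneg (Nat.cast_nonneg _) _)
    (Finset.mem_univ q))
  exact Real.one_le_rpow (mod_cast one_le_card_ball hS hact_one _ _) (by linarith)

/-- Under conditions (1) and (2), the size of the standard portrait of `w` is bounded by a
constant multiple of `N_p(w)`. -/
lemma portraitCard_le_Np [Nonempty V] (hS : S.Finite) (hact_one : ∀ v : V, act v 1 = v)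
    (hact_mul : ∀ (v : V) (g h : G), act (act v g) h = act v (g * h))
    {C d : ℝ} (hC : 1 ≤ C) (hd : 1 ≤ d)
    (hball : ∀ (v : V) (R : ℕ), 1 ≤ R →
      C⁻¹ * (R : ℝ) ^ d ≤ (Nat.card (ball act S v R) : ℝ) ∧
      (Nat.card (ball act S v R) : ℝ) ≤ C * (R : ℝ) ^ d)
    {L : ℝ} (hL : 1 < L)
    (hrep : ∀ (v v' : V) (R : ℕ), 0 < R → ∃ ψ : V → V,
      IsBallEmbedding act S v v' R ⌊L * (R : ℝ)⌋₊ ψ)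
    {p : ℝ} (hp : 1 ≤ p) (w : List S) :
    1 ≤ Np act S w p ∧
      (portraitCard act S w : ℝ) ≤ (C * L ^ d * C + 1) * Np act S w p := by
  have hfin := finite_portrait hS hact_one hact_mul hrep w
  cases nonempty_fintype (Quot (PortraitRel act S w))
  have hN1 : 1 ≤ Np act S w p :=
    Real.one_le_rpow (one_le_Npow hS hact_one w hp) (by positivity)
  refine ⟨hN1, ?_⟩
  have hNpow : Np act S w p ^ p = Npow act S w p := by
    rw [Np, ← Real.rpow_mul (by linarith [one_le_Npow (act := act) hS hact_one w hp]),
      one_div_mul_cancel (by linarith), Real.rpow_one]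
  set N := Np act S w p
  have hd0 : 0 < d := by linarith
  have hCN : 1 ≤ C * N := one_le_mul_of_one_le_of_one_le hC hN1
  set n := ⌊(C * N) ^ (1 / d)⌋₊ with hn
  have hn1 : 1 ≤ n := Nat.le_floor (by
    rw [Nat.cast_one]
    exact Real.one_le_rpow hCN (by positivity))
  have hnd : (n : ℝ) ^ d ≤ C * N := by
    calc (n : ℝ) ^ d ≤ ((C * N) ^ (1 / d)) ^ d := by
          gcongr
          exact Nat.floor_le (by positivity)
      _ = C * N := by
          rw [← Real.rpow_mul (by positivity), one_div_mul_cancel hd0.ne', Real.rpow_one]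
  have hsmall : (({q : Quot (PortraitRel act S w) | rad act S w q.out ≤ n}.ncard : ℕ) : ℝ) ≤
      C * L ^ d * C * N := by
    let v₀ := Classical.arbitrary V
    have hm : 1 ≤ ⌊L * (n : ℝ)⌋₊ := Nat.le_floor (by
      rw [Nat.cast_one]
      exact one_le_mul_of_one_le_of_one_le hL.le (mod_cast hn1))
    calc (({q : Quot (PortraitRel act S w) | rad act S w q.out ≤ n}.ncard : ℕ) : ℝ)
        ≤ Nat.card (ball act S v₀ ⌊L * (n : ℝ)⌋₊) := by
          exact_mod_cast (ncard_portrait_rad_le hS hact_one hact_mul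
            (fun v => hrep v v₀ n hn1) w).2
      _ ≤ C * (⌊L * (n : ℝ)⌋₊ : ℝ) ^ d := (hball v₀ _ hm).2
      _ ≤ C * (L * n) ^ d := by
          gcongr
          exact Nat.floor_le (by positivity)
      _ = C * L ^ d * (n : ℝ) ^ d := by
          rw [Real.mul_rpow (by linarith) (by positivity), mul_assoc]
      _ ≤ C * L ^ d * (C * N) := by gcongr
      _ = C * L ^ d * C * N := by ring
  have hlarge : (({q : Quot (PortraitRel act S w) | rad act S w q.out ≤ n}ᶜ.ncard : ℕ) : ℝ) ≤
      N := by
    classical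
    set T := {q : Quot (PortraitRel act S w) | rad act S w q.out ≤ n}ᶜ
    have hterm : ∀ q ∈ T.toFinset, N ^ (p - 1) ≤
        (Nat.card (ball act S q.out (rad act S w q.out)) : ℝ) ^ (p - 1) := by
      intro q hq
      have hq : n < rad act S w q.out := by simpa [T] using hq
      refine Real.rpow_le_rpow (by linarith) ?_ (by linarith)
      refine le_trans ?_ (hball _ _ (by omega)).1
      rw [le_inv_mul_iff₀ (by linarith)]
      calc C * N = ((C * N) ^ (1 / d)) ^ d := by
            rw [← Real.rpow_mul (by positivity), one_div_mul_cancel hd0.ne', Real.rpow_one]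
        _ ≤ _ := by
            gcongr
            exact (Nat.lt_of_floor_lt hq).le
    have hpos : 0 < N ^ (p - 1) := Real.rpow_pos_of_pos (by linarith) _
    refine le_of_mul_le_mul_right ?_ hpos
    calc (T.ncard : ℝ) * N ^ (p - 1) = ∑ q ∈ T.toFinset, N ^ (p - 1) := by
          rw [Finset.sum_const, Set.ncard_eq_toFinset_card', nsmul_eq_mul]
      _ ≤ ∑ q ∈ T.toFinset,
            (Nat.card (ball act S q.out (rad act S w q.out)) : ℝ) ^ (p - 1) :=
          Finset.sum_le_sum hterm
      _ ≤ Npow act S w p := by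
          rw [Npow, tsum_fintype]
          exact Finset.sum_le_sum_of_subset_of_nonneg (Finset.subset_univ _)
            fun _ _ _ => Real.rpow_nonneg (Nat.cast_nonneg _) _
      _ = N * N ^ (p - 1) := by
          rw [← hNpow, Real.rpow_sub_one (by linarith)]
          field_simp
  have htotal := Set.ncard_add_ncard_compl
    {q : Quot (PortraitRel act S w) | rad act S w q.out ≤ n}
  have : (portraitCard act S w : ℝ) = _ := congrArg Nat.cast htotal.symm
  rw [this]
  push_cast
  linarith

lemma exists_word_Np_le {g : G} {R : ℕ} (hg : g ∈ ballG S R) {p : ℝ}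
    (hN : ∀ w : List S, 1 ≤ Np act S w p) :
    ∃ w : List S, wordProd S w = g ∧ Np act S w p ≤ 2 * Npg act S g p := by
  obtain ⟨t, -, ht⟩ := hg
  have hne : {x : ℝ | ∃ w : List S, wordProd S w = g ∧ Np act S w p = x}.Nonempty :=
    ⟨_, t, ht, rfl⟩
  have h1 : 1 ≤ Npg act S g p :=
    le_csInf hne (by rintro _ ⟨w, -, rfl⟩; exact hN w)
  obtain ⟨_, ⟨w, hw, rfl⟩, hlt⟩ :=
    exists_lt_of_csInf_lt hne (show Npg act S g p < 2 * Npg act S g p by linarith)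
  exact ⟨w, hw, hlt.le⟩

/-- An element of length at most `R` is determined by the portrait of any word representing it,
where the radii are truncated at `R` and balls are replaced by their models. -/
lemma eq_of_portrait_data_eq (hact_one : ∀ v : V, act v 1 = v)
    (hact_mul : ∀ (v : V) (g h : G), act (act v g) h = act v (g * h))
    (hfaithful : ∀ g : G, (∀ v : V, act v g = v) → g = 1)
    {R : ℕ} {c : V → V}
    (hc : ∀ u, LocalHom act S R u (c u) ∧ LocalHom act S R (c u) u)
    {w w' : List S} (hg : wordProd S w ∈ ballG S R) (hg' : wordProd S w' ∈ ballG S R)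
    (h : ∀ q : Quot (PortraitRel act S w), ∃ q' : Quot (PortraitRel act S w'),
      c q'.out = c q.out ∧ min (rad act S w' q'.out) R = min (rad act S w q.out) R ∧
      act (c q'.out) (wordProd S w') = act (c q.out) (wordProd S w)) :
    wordProd S w = wordProd S w' := by
  have hshort {w : List S} (hg : wordProd S w ∈ ballG S R) (u : V) :
      ∃ t : List S, wordProd S t = wordProd S w ∧ Stays act S (min (rad act S w u) R) u t := by
    rcases le_total (rad act S w u) R with hle | hle
    · exact ⟨w, rfl, by rw [min_eq_left hle]; exact stays_rad u w⟩
    · obtain ⟨t, ht, htw⟩ := hg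
      exact ⟨t, htw, by rw [min_eq_right hle]; exact stays_of_length_le u ht⟩
  have hact : ∀ v, act v (wordProd S w) = act v (wordProd S w') := by
    intro v
    let q := Quot.mk (PortraitRel act S w) v
    obtain ⟨-, huv, -⟩ := localHom_of_quot_eq hact_one hact_mul (Quot.out_eq q)
    obtain ⟨q', hcq, hr, hend⟩ := h q
    obtain ⟨t, ht, hts⟩ := hshort hg q.out
    obtain ⟨t', ht', hts'⟩ := hshort hg' q'.out
    rw [hr] at hts'
    rw [← ht, ← ht', hcq] at hend
    have hts'' := ((hc q'.out).1.mono (min_le_right _ _)).stays hts'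
    rw [hcq] at hts''
    have hmodel := (hc q.out).2.mono (min_le_right (rad act S w q.out) R)
    have hcs := ((hc q.out).1.mono (min_le_right _ _)).stays hts
    rw [← ht, ← ht']
    exact (huv.mono (min_le_left _ R)) t t' hts (hmodel.stays hts'')
      (hmodel t t' hcs hts'' hend.symm)
  refine mul_inv_eq_one.1 (hfaithful _ fun v => ?_)
  rw [← hact_mul, hact, hact_mul, mul_inv_cancel, hact_one]

lemma groupGrowth_le_pow [Nonempty V] (hS : S.Finite) (hact_one : ∀ v : V, act v 1 = v)
    (hact_mul : ∀ (v : V) (g h : G), act (act v g) h = act v (g * h))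
    (hfaithful : ∀ g : G, (∀ v : V, act v g = v) → g = 1)
    {R m k : ℕ} {v₀ : V}
    (hrep : ∀ v : V, ∃ ψ : V → V, IsBallEmbedding act S v v₀ R k ψ)
    (hw : ∀ g ∈ ballG S R, ∃ w : List S, wordProd S w = g ∧
      Finite (Quot (PortraitRel act S w)) ∧ portraitCard act S w ≤ m) :
    groupGrowth S R ≤
      (Nat.card (ball act S v₀ k) * ((R + 1) * Nat.card (ball act S v₀ (k + R)))) ^ m := by
  obtain ⟨c, hc⟩ := exists_local_model hact_one hact_mul hrep
  choose! W hWg hWfin hWcard using hw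
  have hsurj (g : ballG S R) : ∃ f : Fin m → Quot (PortraitRel act S (W g)),
      Function.Surjective f := by
    have := hWfin g g.2
    have : Nonempty (Quot (PortraitRel act S (W g))) := ⟨Quot.mk _ v₀⟩
    let e := Finite.equivFin (Quot (PortraitRel act S (W g)))
    have hi : Function.Injective fun q => Fin.castLE (hWcard g g.2) (e q) :=
      (Fin.castLE_injective _).comp e.injective
    exact ⟨_, Function.invFun_surjective hi⟩
  choose f hf using hsurj
  have hmem (g : ballG S R) (u : V) : act (c u) (wordProd S (W g)) ∈ ball act S v₀ (k + R) := by
    obtain ⟨a, ha, hau⟩ := (hc u).1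
    obtain ⟨b, hb, hbg⟩ := g.2
    refine ⟨a ++ b, by simp; omega, ?_⟩
    rw [hWg g g.2, ← hbg, ← hau, hact_mul]
    simp [wordProd]
  have := (ball_finite (act := act) hS v₀ k).to_subtype
  have := (ball_finite (act := act) hS v₀ (k + R)).to_subtype
  let D (g : ballG S R) (i : Fin m) :
      ball act S v₀ k × Fin (R + 1) × ball act S v₀ (k + R) :=
    (⟨c (f g i).out, (hc _).1⟩,
      ⟨min (rad act S (W g) (f g i).out) R, Nat.lt_succ_of_le (min_le_right _ _)⟩,
      ⟨act (c (f g i).out) (wordProd S (W g)), hmem g _⟩)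
  have hD : Function.Injective D := by
    intro g g' h
    refine Subtype.ext ?_
    rw [← hWg g g.2, ← hWg g' g'.2]
    refine eq_of_portrait_data_eq hact_one hact_mul hfaithful (fun u => (hc u).2)
      (by rw [hWg g g.2]; exact g.2) (by rw [hWg g' g'.2]; exact g'.2) fun q => ?_
    obtain ⟨i, rfl⟩ := hf g q
    have hi := congrFun h i
    simp only [D, Prod.mk.injEq, Subtype.mk.injEq, Fin.mk.injEq] at hi
    exact ⟨f g' i, hi.1.symm, hi.2.1.symm, hi.2.2.symm⟩
  have := Nat.card_le_card_of_injective D hD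
  simpa [groupGrowth, Nat.card_prod, Nat.card_fun] using this

end Words


/-- Under conditions (1) and (2) on `Γ`, for every `p ≥ 1` there
exists `K > 0` such that the growth of `G` satisfies `γ_G(R) ≤ R^{K·N_p(R)}`
for all `R ≥ 2`. -/
theorem growth_le_rpow_NpR
    (S : Set G) (hSfin : S.Finite) (hSsym : ∀ s ∈ S, s⁻¹ ∈ S)
    (hSgen : Subgroup.closure S = ⊤)
    (act : V → G → V)
    (hact_one : ∀ v : V, act v 1 = v)
    (hact_mul : ∀ (v : V) (g h : G), act (act v g) h = act v (g * h))
    (hfaithful : ∀ g : G, (∀ v : V, act v g = v) → g = 1)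
    (htrans : ∀ u v : V, ∃ g : G, act u g = v)
    -- condition (1): polynomial growth of the balls
    (C d : ℝ) (hC : 1 ≤ C) (hd : 1 ≤ d)
    (hball : ∀ (v : V) (R : ℕ), 1 ≤ R →
      C⁻¹ * (R : ℝ) ^ d ≤ (Nat.card (ball act S v R) : ℝ) ∧
      (Nat.card (ball act S v R) : ℝ) ≤ C * (R : ℝ) ^ d)
    -- condition (2): linear repetitivity
    (L : ℝ) (hL : 1 < L)
    (hrep : ∀ (v v' : V) (R : ℕ), 0 < R → ∃ ψ : V → V,
      IsBallEmbedding act S v v' R ⌊L * (R : ℝ)⌋₊ ψ)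
    :
    ∀ p : ℝ, 1 ≤ p → ∃ K : ℝ, 0 < K ∧ ∀ R : ℕ, 2 ≤ R →
      (groupGrowth S R : ℝ) ≤ (R : ℝ) ^ (K * NpR act S R p) := by
  intro p hp
  have hL0 : 0 < L := by linarith
  have hlog : 0 ≤ Real.logb 2 (C ^ 2 * (L + 1) ^ (2 * d) * 2) := by
    refine Real.logb_nonneg (by norm_num) ?_
    have : 1 ≤ (L + 1) ^ (2 * d) := Real.one_le_rpow (by linarith) (by linarith)
    nlinarith [one_le_pow₀ hC (n := 2)]
  set κ := Real.logb 2 (C ^ 2 * (L + 1) ^ (2 * d) * 2) + (2 * d + 1) with hκ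
  set K := C * L ^ d * C + 1 with hK
  have hκ0 : 0 < κ := by linarith
  have hK0 : 0 < K := by positivity
  refine ⟨κ * (K * 2), by positivity, fun R hR => ?_⟩
  have hR2 : (2 : ℝ) ≤ R := mod_cast hR
  have hNpR : 0 ≤ NpR act S R p := NpR_nonneg R p
  rcases isEmpty_or_nonempty V with hV | hV
  · have : Subsingleton G := ⟨fun a b => by
      rw [hfaithful a fun v => hV.elim v, hfaithful b fun v => hV.elim v]⟩
    have h1 : groupGrowth S R ≤ 1 := Finite.card_le_one_iff_subsingleton.2 inferInstance
    calc (groupGrowth S R : ℝ) ≤ 1 := mod_cast h1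
      _ ≤ _ := Real.one_le_rpow (by linarith) (by positivity)
  have hport := portraitCard_le_Np hSfin hact_one hact_mul hC hd hball hL hrep hp
  let v₀ := Classical.arbitrary V
  set k := ⌊L * (R : ℝ)⌋₊ with hk
  have hgrowth := groupGrowth_le_pow (m := ⌊K * (2 * NpR act S R p)⌋₊) hSfin hact_one hact_mul
    hfaithful (fun v => hrep v v₀ R (by omega)) fun g hg => by
      obtain ⟨w, hwg, hw⟩ := exists_word_Np_le hg fun w => (hport w).1
      refine ⟨w, hwg, finite_portrait hSfin hact_one hact_mul hrep w, Nat.le_floor ?_⟩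
      refine (hport w).2.trans (mul_le_mul_of_nonneg_left (hw.trans ?_) hK0.le)
      linarith [Npg_le_NpR (act := act) hSfin hg p]
  rw [← hk] at hgrowth
  have hk1 : 1 ≤ k := Nat.le_floor (by push_cast; nlinarith)
  have hkL : (k : ℝ) ≤ L * R := Nat.floor_le (by positivity)
  have hB {n : ℕ} (hn1 : 1 ≤ n) (hn : (n : ℝ) ≤ (L + 1) * R) :
      (Nat.card (ball act S v₀ n) : ℝ) ≤ C * ((L + 1) ^ d * (R : ℝ) ^ d) := by
    refine (hball v₀ n hn1).2.trans ?_
    rw [← Real.mul_rpow (by positivity) (by positivity)]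
    gcongr
  have hU : ((Nat.card (ball act S v₀ k) * ((R + 1) * Nat.card (ball act S v₀ (k + R))) : ℕ) : ℝ)
      ≤ (R : ℝ) ^ κ := by
    have h1 := hB hk1 (by linarith)
    have h2 := hB (n := k + R) (by omega) (by push_cast; linarith)
    push_cast
    calc (Nat.card (ball act S v₀ k) : ℝ) * (((R : ℝ) + 1) * Nat.card (ball act S v₀ (k + R)))
        ≤ C * ((L + 1) ^ d * (R : ℝ) ^ d) * ((2 * R) * (C * ((L + 1) ^ d * (R : ℝ) ^ d))) := by
          gcongr
          linarith
      _ = (C ^ 2 * (L + 1) ^ (2 * d) * 2) * (R : ℝ) ^ (2 * d + 1) := by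
          rw [Real.rpow_add_one (by positivity), two_mul d, Real.rpow_add (by positivity),
            Real.rpow_add (by positivity)]
          ring
      _ = 2 ^ Real.logb 2 (C ^ 2 * (L + 1) ^ (2 * d) * 2) * (R : ℝ) ^ (2 * d + 1) := by
          rw [Real.rpow_logb (by norm_num) (by norm_num) (by positivity)]
      _ ≤ (R : ℝ) ^ Real.logb 2 (C ^ 2 * (L + 1) ^ (2 * d) * 2) * (R : ℝ) ^ (2 * d + 1) := by
          gcongr
      _ = (R : ℝ) ^ κ := by rw [hκ, Real.rpow_add (by positivity) (_ : ℝ) (2 * d + 1)]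
  calc (groupGrowth S R : ℝ)
      ≤ ((Nat.card (ball act S v₀ k) * ((R + 1) * Nat.card (ball act S v₀ (k + R))) : ℕ) : ℝ) ^
          ⌊K * (2 * NpR act S R p)⌋₊ := mod_cast hgrowth
    _ ≤ ((R : ℝ) ^ κ) ^ ⌊K * (2 * NpR act S R p)⌋₊ := by gcongr
    _ = (R : ℝ) ^ (κ * ⌊K * (2 * NpR act S R p)⌋₊) := by
        rw [Real.rpow_mul (by positivity), Real.rpow_natCast]
    _ ≤ (R : ℝ) ^ (κ * (K * 2) * NpR act S R p) := by
        refine Real.rpow_le_rpow_of_exponent_le (by linarith) ?_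
        rw [mul_assoc κ, mul_assoc K]
        gcongr
        exact Nat.floor_le (by positivity)

end ActionGrowth
end
end
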